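/- arXiv:2104.09155 — 7 statements merged into one kernel-verified Lean document; each statement's English description precedes it below -/
import Mathlib

section
/- Let ∗ be a t-norm continuous at the 1-boundary, let {aₙ}, {bₙ}, {cₙ}, {dₙ}, {eₙ} be sequences in [0,1] and let L ∈ [0,1] be such that {aₙ} → L, {bₙ} → 1, {dₙ} → 1 and {eₙ} → L. If aₙ ≥ bₙ ∗ cₙ ∗ dₙ ≥ eₙ for all n ∈ ℕ, then {cₙ} converges to L. -/
open Filter Topology Set

/-- A triangular norm on the unit interval `[0,1]`. -/
structure IsTNorm (star : ℝ → ℝ → ℝ) : Prop where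
  mem : ∀ a ∈ Set.Icc (0:ℝ) 1, ∀ b ∈ Set.Icc (0:ℝ) 1, star a b ∈ Set.Icc (0:ℝ) 1
  assoc : ∀ a ∈ Set.Icc (0:ℝ) 1, ∀ b ∈ Set.Icc (0:ℝ) 1, ∀ c ∈ Set.Icc (0:ℝ) 1,
    star (star a b) c = star a (star b c)
  comm : ∀ a ∈ Set.Icc (0:ℝ) 1, ∀ b ∈ Set.Icc (0:ℝ) 1, star a b = star b a
  mono_left : ∀ a ∈ Set.Icc (0:ℝ) 1, ∀ b ∈ Set.Icc (0:ℝ) 1, ∀ c ∈ Set.Icc (0:ℝ) 1,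
    a ≤ b → star a c ≤ star b c
  mono_right : ∀ a ∈ Set.Icc (0:ℝ) 1, ∀ b ∈ Set.Icc (0:ℝ) 1, ∀ c ∈ Set.Icc (0:ℝ) 1,
    b ≤ c → star a b ≤ star a c
  unit : ∀ a ∈ Set.Icc (0:ℝ) 1, star a 1 = a

/-- A t-norm is continuous at the 1-boundary if `tₙ → 1` and `sₙ → s` imply `tₙ ∗ sₙ → s`,
for sequences with values in `[0,1]`. -/
def ContinuousAt1Boundary (star : ℝ → ℝ → ℝ) : Prop :=
  ∀ (t s : ℕ → ℝ) (l : ℝ), (∀ n, t n ∈ Set.Icc (0:ℝ) 1) → (∀ n, s n ∈ Set.Icc (0:ℝ) 1) →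
    Filter.Tendsto t Filter.atTop (nhds 1) → Filter.Tendsto s Filter.atTop (nhds l) →
    Filter.Tendsto (fun n => star (t n) (s n)) Filter.atTop (nhds l)

/-- A fuzzy metric space in the sense of Kramosil and Michálek (KM-FMS). -/
structure IsKMFMS {X : Type*} (M : X → X → ℝ → ℝ) (star : ℝ → ℝ → ℝ) : Prop where
  tnorm : IsTNorm star
  mem : ∀ x y : X, ∀ t : ℝ, 0 ≤ t → M x y t ∈ Set.Icc (0:ℝ) 1
  km1 : ∀ x y : X, M x y 0 = 0
  km2 : ∀ x y : X, (∀ t : ℝ, 0 < t → M x y t = 1) ↔ x = y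
  km3 : ∀ x y : X, ∀ t : ℝ, M x y t = M y x t
  km4 : ∀ x y z : X, ∀ t s : ℝ, 0 ≤ t → 0 ≤ s → star (M x y t) (M y z s) ≤ M x z (t + s)
  km5 : ∀ x y : X, ∀ t : ℝ, 0 < t → ContinuousWithinAt (M x y) (Set.Iio t) t

/-- A sequence is `M`-Cauchy in a fuzzy space `(X, M)`. -/
def MCauchy {X : Type*} (M : X → X → ℝ → ℝ) (x : ℕ → X) : Prop :=
  ∀ ε ∈ Set.Ioo (0:ℝ) 1, ∀ t : ℝ, 0 < t →
    ∃ n₀ : ℕ, ∀ n ≥ n₀, ∀ m ≥ n₀, 1 - ε < M (x n) (x m) t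

/-- A sequence `M`-converges to `z` in a fuzzy space `(X, M)`. -/
def MConv {X : Type*} (M : X → X → ℝ → ℝ) (x : ℕ → X) (z : X) : Prop :=
  ∀ ε ∈ Set.Ioo (0:ℝ) 1, ∀ t : ℝ, 0 < t →
    ∃ n₀ : ℕ, ∀ n ≥ n₀, 1 - ε < M (x n) z t

/-- The fuzzy space `(X, M)` is complete. -/
def MComplete {X : Type*} (M : X → X → ℝ → ℝ) : Prop :=
  ∀ x : ℕ → X, MCauchy M x → ∃ z : X, MConv M x z

/-- Property 𝒩𝒞 ("not Cauchy") of a fuzzy space `(X, M)`. -/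
def PropertyNC {X : Type*} (M : X → X → ℝ → ℝ) : Prop :=
  ∀ x : ℕ → X, ¬ MCauchy M x →
    (∀ t : ℝ, 0 < t → Filter.Tendsto (fun n => M (x n) (x (n+1)) t) Filter.atTop (nhds 1)) →
    ∃ ε₀ ∈ Set.Ioo (0:ℝ) 1, ∃ t₀ : ℝ, 0 < t₀ ∧ ∃ nf mf : ℕ → ℕ,
      (∀ k : ℕ, k < nf k ∧ nf k < mf k ∧ mf k < nf (k+1)) ∧
      (∀ k : ℕ, 1 - ε₀ < M (x (nf k)) (x (mf k - 1)) t₀ ∧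
        M (x (nf k)) (x (mf k)) t₀ ≤ 1 - ε₀) ∧
      Filter.Tendsto (fun k => M (x (nf k)) (x (mf k)) t₀) Filter.atTop (nhds (1 - ε₀)) ∧
      Filter.Tendsto (fun k => M (x (nf k - 1)) (x (mf k - 1)) t₀) Filter.atTop (nhds (1 - ε₀))

/-- The canonical fuzzy set `M^d` associated to a metric space `(X, d)`. -/
noncomputable def Md {X : Type*} [MetricSpace X] (x y : X) (t : ℝ) : ℝ :=
  if t ≤ 0 then 0 else t / (t + dist x y)

/-- `x S* y` means `x S y` and `x ≠ y`. -/
def SStar {X : Type*} (S : X → X → Prop) (x y : X) : Prop := S x y ∧ x ≠ y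

/-- A sequence is `S`-strictly-increasing: `xₙ S xₘ` and `xₙ ≠ xₘ` for all `n < m`. -/
def SStrictIncr {X : Type*} (S : X → X → Prop) (x : ℕ → X) : Prop :=
  ∀ n m : ℕ, n < m → S (x n) (x m) ∧ x n ≠ x m

/-- A subset `Z` is `(S, M)`-strictly-increasing-complete. -/
def SICComplete {X : Type*} (M : X → X → ℝ → ℝ) (S : X → X → Prop) (Z : Set X) : Prop :=
  ∀ x : ℕ → X, (∀ n, x n ∈ Z) → SStrictIncr S x → MCauchy M x → ∃ z ∈ Z, MConv M x z

/-- A subset `Y` is `(S, M)`-strictly-increasing-precomplete. -/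
def SICPrecomplete {X : Type*} (M : X → X → ℝ → ℝ) (S : X → X → Prop) (Y : Set X) : Prop :=
  ∃ Z : Set X, Y ⊆ Z ∧ SICComplete M S Z

/-- `T` is `S`-strictly-increasing-continuous. -/
def SICContinuous {X : Type*} (M : X → X → ℝ → ℝ) (S : X → X → Prop) (T : X → X) : Prop :=
  ∀ (x : ℕ → X) (z : X), SStrictIncr S x → MConv M x z → MConv M (fun n => T (x n)) (T z)

/-- `(X, M)` is `S`-strictly-increasing-regular. -/
def SIRegular {X : Type*} (M : X → X → ℝ → ℝ) (S : X → X → Prop) : Prop :=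
  ∀ (x : ℕ → X) (z : X), SStrictIncr S x → MConv M x z → ∀ n : ℕ, S (x n) z

/-- `(X, M)` is metrically-`S`-strictly-increasing-regular. -/
def MetricSIRegular {X : Type*} (M : X → X → ℝ → ℝ) (S : X → X → Prop) : Prop :=
  ∀ (x : ℕ → X) (z : X), SStrictIncr S x → MConv M x z →
    (∀ n : ℕ, ∀ t : ℝ, 0 < t → 0 < M (x n) (x (n+1)) t) →
    ∀ n : ℕ, S (x n) z ∧ ∀ t : ℝ, 0 < t → 0 < M (x n) z t

/-- `z` is `S`-comparable to `x`. -/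
def SComparable {X : Type*} (S : X → X → Prop) (z x : X) : Prop := S z x ∨ S x z

/-- A `(T, S*, M)`-sequence of pairs of functions. -/
def TSMSeq {X : Type*} (M : X → X → ℝ → ℝ) (S : X → X → Prop) (T : X → X)
    (φ ψ : ℕ → ℝ → ℝ) : Prop :=
  ∃ x y : ℕ → X, ∀ n : ℕ,
    SStar S (x n) (y n) ∧ SStar S (T (x n)) (T (y n)) ∧
    ∀ t : ℝ, 0 < t → φ n t = M (T (x n)) (T (y n)) t ∧ ψ n t = M (x n) (y n) t

/-- Condition (F1). -/
def PropF1 {X : Type*} (M : X → X → ℝ → ℝ) (S : X → X → Prop) (T : X → X)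
    (B : Set (ℝ × ℝ)) : Prop :=
  B.Nonempty ∧ ∀ x y : X, ∀ t : ℝ, 0 ≤ t → SStar S x y → SStar S (T x) (T y) →
    (M (T x) (T y) t, M x y t) ∈ B

/-- Condition (F2). -/
def PropF2 {X : Type*} (M : X → X → ℝ → ℝ) (S : X → X → Prop) (T : X → X)
    (θ : ℝ → ℝ → ℝ) : Prop :=
  ∀ x : ℕ → X, (∀ n, x (n+1) = T (x n)) → SStrictIncr S x →
    (∀ n : ℕ, ∀ t : ℝ, 0 < t → 0 ≤ θ (M (x (n+1)) (x (n+2)) t) (M (x n) (x (n+1)) t)) →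
    ∀ t : ℝ, 0 < t → Filter.Tendsto (fun n => M (x n) (x (n+1)) t) Filter.atTop (nhds 1)

/-- Condition (F̃2) (type-2 version of (F2)). -/
def PropF2t {X : Type*} (M : X → X → ℝ → ℝ) (S : X → X → Prop) (T : X → X)
    (θ : ℝ → ℝ → ℝ) : Prop :=
  ∀ x : ℕ → X, (∀ n, x (n+1) = T (x n)) → SStrictIncr S x →
    (∀ n : ℕ, ∀ t : ℝ, 0 < t → 0 < M (x n) (x (n+1)) t ∧
      0 ≤ θ (M (x (n+1)) (x (n+2)) t) (M (x n) (x (n+1)) t)) →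
    ∀ t : ℝ, 0 < t → Filter.Tendsto (fun n => M (x n) (x (n+1)) t) Filter.atTop (nhds 1)

/-- Condition (F3). -/
def PropF3 {X : Type*} (M : X → X → ℝ → ℝ) (S : X → X → Prop) (T : X → X)
    (θ : ℝ → ℝ → ℝ) : Prop :=
  ∀ φ ψ : ℕ → ℝ → ℝ, TSMSeq M S T φ ψ → ∀ t₀ : ℝ, 0 < t₀ → ∀ L ∈ Set.Icc (0:ℝ) 1,
    Filter.Tendsto (fun n => φ n t₀) Filter.atTop (nhds L) →
    Filter.Tendsto (fun n => ψ n t₀) Filter.atTop (nhds L) →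
    (∀ n : ℕ, φ n t₀ < L) → (∀ n : ℕ, 0 ≤ θ (φ n t₀) (ψ n t₀)) → L = 1

/-- Condition (F4). -/
def PropF4 {X : Type*} (M : X → X → ℝ → ℝ) (S : X → X → Prop) (T : X → X)
    (θ : ℝ → ℝ → ℝ) : Prop :=
  ∀ x y : X, ∀ t : ℝ, 0 < t → SStar S x y → SStar S (T x) (T y) →
    0 ≤ θ (M (T x) (T y) t) (M x y t)

/-- Condition (F̃4) (type-2 version of (F4)). -/
def PropF4t {X : Type*} (M : X → X → ℝ → ℝ) (S : X → X → Prop) (T : X → X)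
    (θ : ℝ → ℝ → ℝ) : Prop :=
  ∀ x y : X, ∀ t₀ : ℝ, 0 < t₀ → SStar S x y → SStar S (T x) (T y) → 0 < M x y t₀ →
    0 ≤ θ (M (T x) (T y) t₀) (M x y t₀)

/-- Property (F5). -/
def PropF5 {X : Type*} (M : X → X → ℝ → ℝ) (S : X → X → Prop) (T : X → X)
    (θ : ℝ → ℝ → ℝ) : Prop :=
  ∀ φ ψ : ℕ → ℝ → ℝ, TSMSeq M S T φ ψ →
    (∀ t : ℝ, 0 < t → Filter.Tendsto (fun n => ψ n t) Filter.atTop (nhds 1)) →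
    (∀ n : ℕ, ∀ t : ℝ, 0 < t → 0 ≤ θ (φ n t) (ψ n t)) →
    ∀ t : ℝ, 0 < t → Filter.Tendsto (fun n => φ n t) Filter.atTop (nhds 1)

/-- Property (F̃5) (type-2 version of (F5)). -/
def PropF5t {X : Type*} (M : X → X → ℝ → ℝ) (S : X → X → Prop) (T : X → X)
    (θ : ℝ → ℝ → ℝ) : Prop :=
  ∀ φ ψ : ℕ → ℝ → ℝ, TSMSeq M S T φ ψ →
    (∀ n : ℕ, ∀ t : ℝ, 0 < t → 0 < φ n t ∧ 0 < ψ n t) →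
    (∀ t : ℝ, 0 < t → Filter.Tendsto (fun n => ψ n t) Filter.atTop (nhds 1)) →
    (∀ n : ℕ, ∀ t : ℝ, 0 < t → 0 ≤ θ (φ n t) (ψ n t)) →
    ∀ t : ℝ, 0 < t → Filter.Tendsto (fun n => φ n t) Filter.atTop (nhds 1)

/-- Property (F2'). -/
def PropF2prime {X : Type*} (M : X → X → ℝ → ℝ) (S : X → X → Prop) (T : X → X)
    (θ : ℝ → ℝ → ℝ) : Prop :=
  ∀ x y : ℕ → X, (∀ n, x (n+1) = T (x n)) → (∀ n, y (n+1) = T (y n)) →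
    (∀ n : ℕ, SStar S (x n) (y n)) →
    (∀ n : ℕ, ∀ t : ℝ, 0 < t → 0 ≤ θ (M (x (n+1)) (y (n+1)) t) (M (x n) (y n) t)) →
    ∀ t : ℝ, 0 < t → Filter.Tendsto (fun n => M (x n) (y n) t) Filter.atTop (nhds 1)

/-- Property (F̃2') (type-2 version of (F2')). -/
def PropF2tprime {X : Type*} (M : X → X → ℝ → ℝ) (S : X → X → Prop) (T : X → X)
    (θ : ℝ → ℝ → ℝ) : Prop :=
  ∀ x y : ℕ → X, (∀ n, x (n+1) = T (x n)) → (∀ n, y (n+1) = T (y n)) →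
    (∀ n : ℕ, SStar S (x n) (y n)) →
    (∀ n : ℕ, ∀ t : ℝ, 0 < t → 0 < M (x n) (y n) t ∧
      0 ≤ θ (M (x (n+1)) (y (n+1)) t) (M (x n) (y n) t)) →
    ∀ t : ℝ, 0 < t → Filter.Tendsto (fun n => M (x n) (y n) t) Filter.atTop (nhds 1)

/-- A (type-1) fuzzy ample spectrum contraction w.r.t. `(M, S, θ)`. -/
def IsFASC {X : Type*} (M : X → X → ℝ → ℝ) (S : X → X → Prop) (T : X → X)
    (B : Set (ℝ × ℝ)) (θ : ℝ → ℝ → ℝ) : Prop :=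
  PropF1 M S T B ∧ PropF2 M S T θ ∧ PropF3 M S T θ ∧ PropF4 M S T θ

/-- A type-2 fuzzy ample spectrum contraction w.r.t. `(M, S, θ)`. -/
def IsFASC2 {X : Type*} (M : X → X → ℝ → ℝ) (S : X → X → Prop) (T : X → X)
    (B : Set (ℝ × ℝ)) (θ : ℝ → ℝ → ℝ) : Prop :=
  PropF1 M S T B ∧ PropF2t M S T θ ∧ PropF3 M S T θ ∧ PropF4t M S T θ

/-- A `(T, S*)`-sequence of pairs of real numbers in a metric space. -/
def TSSeq {X : Type*} [MetricSpace X] (S : X → X → Prop) (T : X → X)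
    (a b : ℕ → ℝ) : Prop :=
  ∃ x y : ℕ → X, ∀ n : ℕ, SStar S (x n) (y n) ∧ SStar S (T (x n)) (T (y n)) ∧
    a n = dist (T (x n)) (T (y n)) ∧ b n = dist (x n) (y n)

/-- Condition (B1). -/
def PropB1 {X : Type*} [MetricSpace X] (S : X → X → Prop) (A : Set ℝ) : Prop :=
  A.Nonempty ∧ ∀ x y : X, SStar S x y → dist x y ∈ A

/-- Condition (B2). -/
def PropB2 {X : Type*} [MetricSpace X] (S : X → X → Prop) (T : X → X)
    (ϱ : ℝ → ℝ → ℝ) : Prop :=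
  ∀ x : ℕ → X, (∀ n, x (n+1) = T (x n)) → (∀ n : ℕ, S (x n) (x (n+1))) →
    (∀ n : ℕ, x n ≠ x (n+1)) →
    (∀ n : ℕ, 0 ≤ ϱ (dist (x (n+1)) (x (n+2))) (dist (x n) (x (n+1)))) →
    Filter.Tendsto (fun n => dist (x n) (x (n+1))) Filter.atTop (nhds 0)

/-- Condition (B3). -/
def PropB3 {X : Type*} [MetricSpace X] (S : X → X → Prop) (T : X → X)
    (A : Set ℝ) (ϱ : ℝ → ℝ → ℝ) : Prop :=
  ∀ a b : ℕ → ℝ, (∀ n : ℕ, a n ∈ A ∧ b n ∈ A) → TSSeq S T a b →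
    ∀ L : ℝ, 0 ≤ L → Filter.Tendsto a Filter.atTop (nhds L) →
    Filter.Tendsto b Filter.atTop (nhds L) →
    (∀ n : ℕ, L < a n) → (∀ n : ℕ, 0 ≤ ϱ (a n) (b n)) → L = 0

/-- Condition (B4). -/
def PropB4 {X : Type*} [MetricSpace X] (S : X → X → Prop) (T : X → X)
    (ϱ : ℝ → ℝ → ℝ) : Prop :=
  ∀ x y : X, SStar S x y → SStar S (T x) (T y) → 0 ≤ ϱ (dist (T x) (T y)) (dist x y)

/-- An ample spectrum contraction w.r.t. `S` and `ϱ` in a metric space. -/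
def IsASC {X : Type*} [MetricSpace X] (S : X → X → Prop) (T : X → X)
    (A : Set ℝ) (ϱ : ℝ → ℝ → ℝ) : Prop :=
  PropB1 (X := X) S A ∧ PropB2 S T ϱ ∧ PropB3 S T A ϱ ∧ PropB4 S T ϱ

/-- Property (B2'). -/
def PropB2prime {X : Type*} [MetricSpace X] (S : X → X → Prop) (T : X → X)
    (ϱ : ℝ → ℝ → ℝ) : Prop :=
  ∀ x₁ x₂ : X, (∀ n : ℕ, SStar S (T^[n] x₁) (T^[n] x₂)) →
    (∀ n : ℕ, 0 ≤ ϱ (dist (T^[n+1] x₁) (T^[n+1] x₂)) (dist (T^[n] x₁) (T^[n] x₂))) →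
    Filter.Tendsto (fun n => dist (T^[n] x₁) (T^[n] x₂)) Filter.atTop (nhds 0)

/-- Property (B5). -/
def PropB5 {X : Type*} [MetricSpace X] (S : X → X → Prop) (T : X → X)
    (ϱ : ℝ → ℝ → ℝ) : Prop :=
  ∀ a b : ℕ → ℝ, TSSeq S T a b → Filter.Tendsto b Filter.atTop (nhds 0) →
    (∀ n : ℕ, 0 ≤ ϱ (a n) (b n)) → Filter.Tendsto a Filter.atTop (nhds 0)

/-- The family Ψ of auxiliary functions of Miheţ. -/
def MemPsi (ψ : ℝ → ℝ) : Prop :=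
  ContinuousOn ψ (Set.Icc 0 1) ∧ MonotoneOn ψ (Set.Icc 0 1) ∧
  (∀ t ∈ Set.Icc (0:ℝ) 1, ψ t ∈ Set.Icc (0:ℝ) 1) ∧ (∀ t ∈ Set.Ioo (0:ℝ) 1, t < ψ t)

/-- Miheţ's fuzzy ψ-contraction. -/
def FuzzyPsiContraction {X : Type*} (M : X → X → ℝ → ℝ) (T : X → X) (ψ : ℝ → ℝ) : Prop :=
  ∀ x y : X, ∀ t : ℝ, 0 < t → 0 < M x y t → ψ (M x y t) ≤ M (T x) (T y) t

/-- the cancellation property for t-norms continuous at the 1-boundary. -/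
theorem tnorm_cancellation (star : ℝ → ℝ → ℝ) (hT : IsTNorm star)
    (hB : ContinuousAt1Boundary star)
    (a b c d e : ℕ → ℝ) (L : ℝ)
    (ha : ∀ n, a n ∈ Set.Icc (0:ℝ) 1) (hb : ∀ n, b n ∈ Set.Icc (0:ℝ) 1)
    (hc : ∀ n, c n ∈ Set.Icc (0:ℝ) 1) (hd : ∀ n, d n ∈ Set.Icc (0:ℝ) 1)
    (he : ∀ n, e n ∈ Set.Icc (0:ℝ) 1) (hL : L ∈ Set.Icc (0:ℝ) 1)
    (haL : Filter.Tendsto a Filter.atTop (nhds L))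
    (hb1 : Filter.Tendsto b Filter.atTop (nhds 1))
    (hd1 : Filter.Tendsto d Filter.atTop (nhds 1))
    (heL : Filter.Tendsto e Filter.atTop (nhds L))
    (hineq : ∀ n : ℕ, e n ≤ star (star (b n) (c n)) (d n) ∧
      star (star (b n) (c n)) (d n) ≤ a n) :
    Filter.Tendsto c Filter.atTop (nhds L) := by
  refine tendsto_of_subseq_tendsto fun ns hns => ?_
  obtain ⟨l, -, φ, hφ, hl⟩ := isCompact_Icc.tendsto_subseq (fun n => hc (ns n))
  refine ⟨φ, ?_⟩
  have hs : Tendsto (fun n => ns (φ n)) atTop atTop := hns.comp hφ.tendsto_atTop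
  have hl' : Tendsto (fun n => c (ns (φ n))) atTop (nhds l) := hl
  have h1 := hB (fun n => b (ns (φ n))) (fun n => c (ns (φ n))) l (fun n => hb _)
    (fun n => hc _) (hb1.comp hs) hl'
  have h2 := hB (fun n => d (ns (φ n))) (fun n => star (b (ns (φ n))) (c (ns (φ n)))) l
    (fun n => hd _) (fun n => hT.mem _ (hb _) _ (hc _)) (hd1.comp hs) h1
  have h3 : Tendsto (fun n => star (d (ns (φ n))) (star (b (ns (φ n))) (c (ns (φ n)))))
      atTop (nhds L) := by
    refine tendsto_of_tendsto_of_tendsto_of_le_of_le (heL.comp hs) (haL.comp hs)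
      (fun n => ?_) (fun n => ?_)
    · have h := (hineq (ns (φ n))).1
      rw [hT.comm _ (hT.mem _ (hb _) _ (hc _)) _ (hd _)] at h
      exact h
    · have h := (hineq (ns (φ n))).2
      rw [hT.comm _ (hT.mem _ (hb _) _ (hc _)) _ (hd _)] at h
      exact h
  rw [tendsto_nhds_unique h3 h2]
  exact hl'
end

section
/- Let {xₙ} be a Picard sequence of a self-mapping T : X → X in a KM-FMS (X, M, ∗) such that {M(xₙ, xₙ₊₁, t)} → 1 for all t > 0. If there are n₀, m₀ ∈ ℕ such that n₀ < m₀ and x_{n₀} = x_{m₀}, then there exist ℓ₀ ∈ ℕ and z ∈ X such that xₙ = z for all n ≥ ℓ₀ (that is, {xₙ} is constant from a term onwards), and z is a fixed point of T (T z = z). -/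
open Filter Topology Set

/-- a Picard sequence in a KM-FMS with repeated terms whose consecutive
fuzzy distances tend to 1 is eventually constant, and its value is a fixed point. -/
theorem picard_repeated_implies_eventually_constant {X : Type*}
    (M : X → X → ℝ → ℝ) (star : ℝ → ℝ → ℝ) (hKM : IsKMFMS M star)
    (T : X → X) (x : ℕ → X) (hPicard : ∀ n : ℕ, x (n + 1) = T (x n))
    (hlim : ∀ t : ℝ, 0 < t →
      Filter.Tendsto (fun n => M (x n) (x (n+1)) t) Filter.atTop (nhds 1))
    (n₀ m₀ : ℕ) (hlt : n₀ < m₀) (heq : x n₀ = x m₀) :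
    ∃ (ℓ₀ : ℕ) (z : X), (∀ n ≥ ℓ₀, x n = z) ∧ T z = z := by
  have hper : ∀ j, x (n₀ + j) = x (m₀ + j) := by
    intro j
    induction j with
    | zero => simpa using heq
    | succ k ih => rw [← add_assoc, ← add_assoc, hPicard, hPicard, ih]
  have hmul : ∀ k j, x (n₀ + k * (m₀ - n₀) + j) = x (n₀ + j) := by
    intro k
    induction k with
    | zero => intro j; simp
    | succ k ih =>
      intro j
      have e : n₀ + (k + 1) * (m₀ - n₀) + j = n₀ + k * (m₀ - n₀) + ((m₀ - n₀) + j) := by ring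
      rw [e, ih, hper j]
      congr 1
      omega
  have hsub : Filter.Tendsto (fun k : ℕ => n₀ + k * (m₀ - n₀)) Filter.atTop Filter.atTop := by
    refine Filter.tendsto_atTop_mono (fun k => ?_) Filter.tendsto_id
    have h1 : 1 ≤ m₀ - n₀ := by omega
    have h2 : k * 1 ≤ k * (m₀ - n₀) := Nat.mul_le_mul_left k h1
    simp only [id]
    omega
  have hfix : x n₀ = x (n₀ + 1) := by
    refine (hKM.km2 _ _).1 (fun t ht => ?_)
    have h := (hlim t ht).comp hsub
    have hc : (fun n => M (x n) (x (n+1)) t) ∘ (fun k : ℕ => n₀ + k * (m₀ - n₀))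
        = fun _ => M (x n₀) (x (n₀ + 1)) t := by
      funext k
      have h0 := hmul k 0
      have h1 := hmul k 1
      simp only [add_zero] at h0
      simp only [Function.comp, h0, h1]
    rw [hc] at h
    exact tendsto_nhds_unique tendsto_const_nhds h
  have hT : T (x n₀) = x n₀ := by rw [← hPicard, ← hfix]
  refine ⟨n₀, x n₀, fun n hn => ?_, hT⟩
  induction n, hn using Nat.le_induction with
  | base => rfl
  | succ n _ ih => rw [hPicard, ih, hT]
end

section
/- Each non-Archimedean KM-fuzzy metric space (X, M, ∗) whose t-norm ∗ is continuous at the 1-boundary satisfies property NC. -/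
open Filter Topology Set

/-- every non-Archimedean KM-FMS whose t-norm is continuous at the
1-boundary satisfies property 𝒩𝒞. -/
theorem nonArchimedean_implies_NC {X : Type*}
    (M : X → X → ℝ → ℝ) (star : ℝ → ℝ → ℝ) (hKM : IsKMFMS M star)
    (hNA : ∀ x y z : X, ∀ t : ℝ, 0 < t → star (M x y t) (M y z t) ≤ M x z t)
    (hB : ContinuousAt1Boundary star) :
    PropertyNC M := by
  intro x hnc hlim
  have hT := hKM.tnorm
  unfold MCauchy at hnc
  push Not at hnc
  obtain ⟨ε, hε, t, ht, h⟩ := hnc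
  have hmem : ∀ a b : X, M a b t ∈ Set.Icc (0:ℝ) 1 := fun a b => hKM.mem a b t ht.le
  have hself : ∀ a : X, M a a t = 1 := fun a => (hKM.km2 a a).2 rfl t ht
  have hc0 : (1 - ε) ∈ Set.Icc (0:ℝ) 1 := ⟨by linarith [hε.2], by linarith [hε.1]⟩
  -- selection step
  have hsel : ∀ N : ℕ, ∃ p : ℕ × ℕ, N < p.1 ∧ p.1 < p.2 ∧
      1 - ε < M (x p.1) (x (p.2 - 1)) t ∧ M (x p.1) (x p.2) t ≤ 1 - ε := by
    intro N
    have h1 : ∃ n, N < n ∧ ∃ m, n < m ∧ M (x n) (x m) t ≤ 1 - ε := by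
      obtain ⟨n, hn, m, hm, hnm⟩ := h (N+1)
      rcases lt_trichotomy n m with hlt | heq | hgt
      · exact ⟨n, by omega, m, hlt, hnm⟩
      · subst heq
        rw [hself] at hnm
        linarith [hε.1]
      · exact ⟨m, by omega, n, hgt, by rw [hKM.km3]; exact hnm⟩
    obtain ⟨n, hn, hex⟩ := h1
    classical
    have hs := Nat.find_spec hex
    refine ⟨(n, Nat.find hex), hn, hs.1, ?_, hs.2⟩
    have hmin := Nat.find_min hex (m := Nat.find hex - 1) (by omega)
    dsimp only
    rcases Nat.lt_or_ge n (Nat.find hex - 1) with hlt | hge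
    · by_contra hcon
      exact hmin ⟨hlt, not_lt.1 hcon⟩
    · have : Nat.find hex - 1 = n := by omega
      rw [this, hself]
      linarith [hε.1]
  choose f hf1 hf2 hf3 hf4 using hsel
  let p : ℕ → ℕ × ℕ := fun k => Nat.rec (f 0) (fun _ q => f q.2) k
  have hp0 : p 0 = f 0 := rfl
  have hpS : ∀ k, p (k+1) = f (p k).2 := fun _ => rfl
  have hpf : ∀ k, ∃ N, p k = f N := by
    intro k
    cases k with
    | zero => exact ⟨0, rfl⟩
    | succ k => exact ⟨_, hpS k⟩
  have hA : ∀ k, (p k).1 < (p k).2 := by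
    intro k; obtain ⟨N, hN⟩ := hpf k; rw [hN]; exact hf2 N
  have hB1 : ∀ k, 1 - ε < M (x (p k).1) (x ((p k).2 - 1)) t := by
    intro k; obtain ⟨N, hN⟩ := hpf k; rw [hN]; exact hf3 N
  have hB2 : ∀ k, M (x (p k).1) (x (p k).2) t ≤ 1 - ε := by
    intro k; obtain ⟨N, hN⟩ := hpf k; rw [hN]; exact hf4 N
  have hC : ∀ k, (p k).2 < (p (k+1)).1 := by
    intro k; rw [hpS]; exact hf1 _
  have hD : ∀ k, k < (p k).1 := by
    intro k
    induction k with
    | zero => exact hf1 0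
    | succ k ih => have := hC k; have := hA k; omega
  have htd : ∀ g : ℕ → ℕ, (∀ k, k < g k) →
      Filter.Tendsto (fun k => M (x (g k - 1)) (x (g k)) t) Filter.atTop (nhds 1) := by
    intro g hg
    have hg' : Filter.Tendsto (fun k => g k - 1) Filter.atTop Filter.atTop :=
      Filter.tendsto_atTop_mono (fun k => by have := hg k; simp only [id]; omega) Filter.tendsto_id
    have := (hlim t ht).comp hg'
    refine this.congr (fun k => ?_)
    have h1 : g k - 1 + 1 = g k := by have := hg k; omega
    simp only [Function.comp, h1]
  have ha := htd (fun k => (p k).1) hD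
  have hd := htd (fun k => (p k).2) (fun k => (hD k).trans (hA k))
  have hac : ∀ c ∈ Set.Icc (0:ℝ) 1, Filter.Tendsto
      (fun k => star (M (x ((p k).1 - 1)) (x (p k).1) t) c) Filter.atTop (nhds c) :=
    fun c hc => hB _ (fun _ => c) c (fun k => hmem _ _) (fun _ => hc) ha tendsto_const_nhds
  have hdc : ∀ (s : ℕ → ℝ) (c : ℝ), (∀ k, s k ∈ Set.Icc (0:ℝ) 1) →
      Filter.Tendsto s Filter.atTop (nhds c) → Filter.Tendsto
      (fun k => star (s k) (M (x ((p k).2 - 1)) (x (p k).2) t)) Filter.atTop (nhds c) := by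
    intro s c hs hsc
    refine (hB _ s c (fun k => hmem _ _) hs hd hsc).congr (fun k => ?_)
    exact hT.comm _ (hmem _ _) _ (hs k)
  refine ⟨ε, hε, t, ht, fun k => (p k).1, fun k => (p k).2,
    fun k => ⟨hD k, hA k, hC k⟩, fun k => ⟨hB1 k, hB2 k⟩, ?_, ?_⟩
  · refine tendsto_of_tendsto_of_tendsto_of_le_of_le
      (hdc (fun _ => 1 - ε) (1 - ε) (fun _ => hc0) tendsto_const_nhds)
      tendsto_const_nhds (fun k => ?_) hB2
    exact (hT.mono_left _ hc0 _ (hmem _ _) _ (hmem _ _) (hB1 k).le).trans (hNA _ _ _ t ht)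
  · rw [tendsto_order]
    constructor
    · intro a haa
      filter_upwards [(tendsto_order.1 (hac _ hc0)).1 a haa] with k hk
      exact hk.trans_le
        ((hT.mono_right _ (hmem _ _) _ hc0 _ (hmem _ _) (hB1 k).le).trans (hNA _ _ _ t ht))
    · intro c hc
      rcases lt_or_ge 1 c with h1 | h1
      · exact Filter.Eventually.of_forall (fun k => (hmem _ _).2.trans_lt h1)
      have hcm : c ∈ Set.Icc (0:ℝ) 1 := ⟨hc0.1.trans hc.le, h1⟩
      have hs : ∀ k, star (M (x ((p k).1 - 1)) (x (p k).1) t) c ∈ Set.Icc (0:ℝ) 1 :=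
        fun k => hT.mem _ (hmem _ _) _ hcm
      filter_upwards [(tendsto_order.1 (hdc _ c hs (hac c hcm))).1 _ hc] with k hk
      by_contra hcon
      have hcon := not_lt.1 hcon
      have e1 : star (M (x ((p k).1 - 1)) (x (p k).1) t) c ≤ M (x (p k).1) (x ((p k).2 - 1)) t := by
        refine (hT.mono_right _ (hmem _ _) _ hcm _ (hmem _ _) hcon).trans ?_
        rw [hKM.km3 (x ((p k).1 - 1)) (x (p k).1)]
        exact hNA _ _ _ t ht
      have e2 := (hT.mono_left _ (hs k) _ (hmem _ _) _
        (hmem (x ((p k).2 - 1)) (x (p k).2)) e1).trans (hNA _ _ _ t ht)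
      linarith [hB2 k]
end

section
/- If (X, d) is a metric space, then the fuzzy space (X, M^d) satisfies property NC. -/
open Filter Topology Set

/-- for any metric space `(X, d)`, the fuzzy space `(X, M^d)` satisfies
property 𝒩𝒞. -/
theorem metric_Md_satisfies_NC {X : Type*} [MetricSpace X] :
    PropertyNC (Md (X := X)) := by
  intro x hC hT
  have hMd : ∀ (a b : X) (t : ℝ), 0 < t → Md a b t = t / (t + dist a b) := by
    intro a b t ht
    simp [Md, not_le.mpr ht]
  -- consecutive distances tend to zero
  have hd : Tendsto (fun n => dist (x n) (x (n+1))) atTop (𝓝 0) := by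
    have h1 := (hT 1 one_pos).inv₀ one_ne_zero
    have h2 := h1.sub_const 1
    have h3 : ((1:ℝ)⁻¹ - 1) = 0 := by norm_num
    rw [h3] at h2
    refine h2.congr fun n => ?_
    rw [hMd _ _ _ one_pos]
    simp
  unfold MCauchy at hC
  push Not at hC
  obtain ⟨ε, hε, t, ht, hN⟩ := hC
  have hε0 : 0 < ε := hε.1
  have hε1 : 0 < 1 - ε := by linarith [hε.2]
  obtain ⟨r, hr⟩ : ∃ r, r = t * ε / (1 - ε) := ⟨_, rfl⟩
  have hr0 : 0 < r := by rw [hr]; positivity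
  have hre : r * (1 - ε) = t * ε := by rw [hr]; field_simp
  have hle : ∀ a b : X, Md a b t ≤ 1 - ε ↔ r ≤ dist a b := by
    intro a b
    have hp : 0 < t + dist a b := by positivity
    rw [hMd _ _ _ ht, div_le_iff₀ hp, hr, div_le_iff₀ hε1]
    constructor <;> intro h <;> nlinarith
  have key : ∀ N : ℕ, ∃ n m : ℕ, N < n ∧ n < m ∧ dist (x n) (x (m-1)) < r ∧
      r ≤ dist (x n) (x m) := by
    intro N
    have h1 : ∃ n m : ℕ, N < n ∧ n < m ∧ r ≤ dist (x n) (x m) := by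
      obtain ⟨n, hn, m, hm, h⟩ := hN (N+1)
      rw [hle] at h
      rcases lt_trichotomy n m with h' | h' | h'
      · exact ⟨n, m, by omega, h', h⟩
      · subst h'
        rw [dist_self] at h
        linarith
      · exact ⟨m, n, by omega, h', by rwa [dist_comm]⟩
    obtain ⟨n, m0, hn, hm0⟩ := h1
    classical
    have hex : ∃ m, n < m ∧ r ≤ dist (x n) (x m) := ⟨m0, hm0⟩
    obtain ⟨hm1, hm2⟩ := Nat.find_spec hex
    refine ⟨n, Nat.find hex, hn, hm1, ?_, hm2⟩
    have hmin := Nat.find_min hex (m := Nat.find hex - 1) (by omega)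
    by_contra hcon
    push Not at hcon
    rcases Nat.lt_or_ge n (Nat.find hex - 1) with h' | h'
    · exact hmin ⟨h', hcon⟩
    · have : Nat.find hex - 1 = n := by omega
      rw [this, dist_self] at hcon
      linarith
  choose F G hF hFG hlt hge using key
  obtain ⟨p, hp⟩ : ∃ p : ℕ → ℕ, ∀ k, p (k+1) = G (p k) :=
    ⟨fun k => Nat.rec 0 (fun _ q => G q) k, fun _ => rfl⟩
  have hpk : ∀ k, k ≤ p k := by
    intro k
    induction k with
    | zero => omega
    | succ k ih =>
      rw [hp]
      have := hF (p k)
      have := hFG (p k)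
      omega
  have hn1 : Tendsto (fun k => F (p k) - 1) atTop atTop :=
    tendsto_atTop_mono (fun k => by have := hF (p k); have := hpk k; simp only [id]; omega)
      tendsto_id
  have hm1 : Tendsto (fun k => G (p k) - 1) atTop atTop :=
    tendsto_atTop_mono (fun k => by
      have := hF (p k); have := hFG (p k); have := hpk k; simp only [id]; omega) tendsto_id
  have hdn : Tendsto (fun k => dist (x (F (p k) - 1)) (x (F (p k)))) atTop (𝓝 0) := by
    refine (hd.comp hn1).congr fun k => ?_
    have h : F (p k) - 1 + 1 = F (p k) := by have := hF (p k); omega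
    simp only [Function.comp, h]
  have hdm : Tendsto (fun k => dist (x (G (p k) - 1)) (x (G (p k)))) atTop (𝓝 0) := by
    refine (hd.comp hm1).congr fun k => ?_
    have h : G (p k) - 1 + 1 = G (p k) := by have := hFG (p k); omega
    simp only [Function.comp, h]
  have hL1 : Tendsto (fun k => dist (x (F (p k))) (x (G (p k)))) atTop (𝓝 r) := by
    have hu := hdm.const_add r
    rw [add_zero] at hu
    refine tendsto_of_tendsto_of_tendsto_of_le_of_le tendsto_const_nhds hu
      (fun k => hge (p k)) (fun k => ?_)
    have := dist_triangle (x (F (p k))) (x (G (p k) - 1)) (x (G (p k)))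
    have := hlt (p k)
    simp only
    linarith
  have hL2 : Tendsto (fun k => dist (x (F (p k) - 1)) (x (G (p k) - 1))) atTop (𝓝 r) := by
    have hu := (hL1.add hdn).add hdm
    have hl := (hL1.sub hdn).sub hdm
    simp only [add_zero, sub_zero] at hu hl
    refine tendsto_of_tendsto_of_tendsto_of_le_of_le hl hu (fun k => ?_) (fun k => ?_)
    · have h1 := dist_triangle4 (x (F (p k))) (x (F (p k) - 1)) (x (G (p k) - 1)) (x (G (p k)))
      rw [dist_comm (x (F (p k))) (x (F (p k) - 1))] at h1
      simp only
      linarith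
    · have h1 := dist_triangle4 (x (F (p k) - 1)) (x (F (p k))) (x (G (p k))) (x (G (p k) - 1))
      rw [dist_comm (x (G (p k))) (x (G (p k) - 1))] at h1
      simp only
      linarith
  have hlim : ∀ a b : ℕ → X, Tendsto (fun k => dist (a k) (b k)) atTop (𝓝 r) →
      Tendsto (fun k => Md (a k) (b k) t) atTop (𝓝 (1 - ε)) := by
    intro a b hab
    have h1 : Tendsto (fun k => t / (t + dist (a k) (b k))) atTop (𝓝 (t / (t + r))) :=
      tendsto_const_nhds.div (hab.const_add t) (by positivity)
    have h2 : t / (t + r) = 1 - ε := by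
      rw [div_eq_iff (by positivity)]
      linarith
    rw [h2] at h1
    exact h1.congr fun k => (hMd _ _ _ ht).symm
  refine ⟨ε, hε, t, ht, fun k => F (p k), fun k => G (p k), fun k => ⟨?_, hFG _, ?_⟩,
    fun k => ⟨?_, (hle _ _).2 (hge _)⟩, hlim _ _ hL1, hlim _ _ hL2⟩
  · exact lt_of_le_of_lt (hpk k) (hF _)
  · simp only [hp]
    exact hF _
  · rw [← not_le, hle, not_le]
    exact hlt _
end

section
/- Let (X, d) be a metric space. Then d satisfies the ultrametric inequality d(x,z) ≤ max{d(x,y), d(y,z)} for all x, y, z ∈ X if, and only if, (X, M^d, ∗_m) is a non-Archimedean KM-FMS with respect to the minimum t-norm ∗_m (t ∗_m s = min{t,s}), i.e., M^d(x,z,t) ≥ min{M^d(x,y,t), M^d(y,z,t)} for all x, y, z ∈ X and all t > 0. -/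
open Filter Topology Set

theorem Md_pos_eq {X : Type*} [MetricSpace X] (x y : X) {t : ℝ} (ht : 0 < t) :
    Md x y t = t / (t + dist x y) := by
  simp [Md, not_le.mpr ht]

theorem Md_mem_unit {X : Type*} [MetricSpace X] (x y : X) (t : ℝ) :
    Md x y t ∈ Set.Icc (0:ℝ) 1 := by
  have hd : 0 ≤ dist x y := dist_nonneg
  rcases le_or_gt t 0 with ht | ht
  · simp [Md, ht]
  · rw [Md_pos_eq x y ht]
    constructor
    · positivity
    · rw [div_le_one (by positivity)]
      linarith

theorem Md_zero_eq {X : Type*} [MetricSpace X] (x y : X) : Md x y 0 = 0 := by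
  simp [Md]

theorem Md_le_iff {X : Type*} [MetricSpace X] (x y z w : X) {t : ℝ} (ht : 0 < t) :
    Md x y t ≤ Md z w t ↔ dist z w ≤ dist x y := by
  have h1 : 0 ≤ dist x y := dist_nonneg
  have h2 : 0 ≤ dist z w := dist_nonneg
  rw [Md_pos_eq x y ht, Md_pos_eq z w ht,
    div_le_div_iff_of_pos_left ht (by positivity) (by positivity)]
  exact add_le_add_iff_left t

theorem isTNorm_min : IsTNorm (fun a b => min a b) where
  mem a ha b hb := ⟨le_min ha.1 hb.1, (min_le_left _ _).trans ha.2⟩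
  assoc a _ b _ c _ := min_assoc a b c
  comm a _ b _ := min_comm a b
  mono_left _ _ _ _ _ _ h := min_le_min_right _ h
  mono_right _ _ _ _ _ _ h := min_le_min_left _ h
  unit a ha := min_eq_left ha.2

theorem isKMFMS_Md_min {X : Type*} [MetricSpace X] :
    IsKMFMS (Md (X := X)) (fun a b => min a b) where
  tnorm := isTNorm_min
  mem x y t _ := Md_mem_unit x y t
  km1 := Md_zero_eq
  km2 x y := by
    constructor
    · intro h
      have h1 := h 1 one_pos
      have hd : 0 ≤ dist x y := dist_nonneg
      rw [Md_pos_eq x y one_pos, div_eq_one_iff_eq (by positivity)] at h1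
      exact dist_eq_zero.mp (by linarith)
    · rintro rfl t ht
      rw [Md_pos_eq x x ht, dist_self, add_zero, div_self ht.ne']
  km3 x y t := by simp only [Md, dist_comm]
  km4 x y z t s ht hs := by
    rcases ht.eq_or_lt with rfl | ht
    · exact (min_le_left _ _).trans (by rw [Md_zero_eq]; exact (Md_mem_unit _ _ _).1)
    rcases hs.eq_or_lt with rfl | hs
    · exact (min_le_right _ _).trans (by rw [Md_zero_eq]; exact (Md_mem_unit _ _ _).1)
    have ha : 0 ≤ dist x y := dist_nonneg
    have hb : 0 ≤ dist y z := dist_nonneg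
    have hc : 0 ≤ dist x z := dist_nonneg
    have htri := dist_triangle x y z
    rw [Md_pos_eq x y ht, Md_pos_eq y z hs, Md_pos_eq x z (add_pos ht hs)]
    rcases le_total (s * dist x y) (t * dist y z) with h | h
    · refine (min_le_right _ _).trans ?_
      rw [div_le_div_iff₀ (by positivity) (by positivity)]
      nlinarith [mul_le_mul_of_nonneg_left htri hs.le]
    · refine (min_le_left _ _).trans ?_
      rw [div_le_div_iff₀ (by positivity) (by positivity)]
      nlinarith [mul_le_mul_of_nonneg_left htri ht.le]
  km5 x y t ht := by
    have hd : 0 ≤ dist x y := dist_nonneg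
    have hc : ContinuousAt (fun t : ℝ => t / (t + dist x y)) t :=
      continuousAt_id.div (continuousAt_id.add continuousAt_const)
        (by positivity)
    refine (hc.congr ?_).continuousWithinAt
    filter_upwards [lt_mem_nhds ht] with u hu
    exact (Md_pos_eq x y hu).symm

/-- a metric `d` is an ultrametric iff `(X, M^d, ∗ₘ)` is a non-Archimedean
KM-FMS with respect to the minimum t-norm. -/
theorem ultrametric_iff_Md_min_nonArchimedean {X : Type*} [MetricSpace X] [Nonempty X] :
    (∀ x y z : X, dist x z ≤ max (dist x y) (dist y z)) ↔
    (IsKMFMS (Md (X := X)) (fun a b => min a b) ∧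
      ∀ x y z : X, ∀ t : ℝ, 0 < t → min (Md x y t) (Md y z t) ≤ Md x z t) := by
  constructor
  · intro h
    refine ⟨isKMFMS_Md_min, fun x y z t ht => ?_⟩
    rw [min_le_iff, Md_le_iff _ _ _ _ ht, Md_le_iff _ _ _ _ ht]
    exact le_max_iff.mp (h x y z)
  · rintro ⟨_, h⟩ x y z
    have h1 := h x y z 1 one_pos
    rw [min_le_iff, Md_le_iff _ _ _ _ one_pos, Md_le_iff _ _ _ _ one_pos] at h1
    exact le_max_iff.mpr h1
end

section
/- Let T : X → X be a fuzzy ψ-contraction in a KM-FMS (X, M, ∗), with ψ ∈ Ψ, and define θ_ψ : [0,1] × [0,1] → ℝ by θ_ψ(t,s) = t − ψ(s) for all t, s ∈ [0,1]. Then T is a type-2 fuzzy ample spectrum contraction with respect to (M, S_X, θ_ψ), where S_X is the trivial binary relation on X (x S_X y for all x, y ∈ X); moreover, T satisfies properties (F̃2') and (F̃5), θ_ψ satisfies the implication θ_ψ(t,s) ≥ 0 and s > 0 ⇒ t > 0, and θ_ψ(t,s) ≤ t − s for all t, s ∈ [0,1]. -/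
open Filter Topology Set

theorem aux_psi_one {ψ : ℝ → ℝ} (hψ : MemPsi ψ) : ψ 1 = 1 := by
  obtain ⟨hc, hm, hr, hl⟩ := hψ
  apply le_antisymm (hr 1 (by simp)).2
  by_contra h
  push Not at h
  have h0 := (hr 1 (by simp)).1
  have hmem : (ψ 1 + 1) / 2 ∈ Set.Ioo (0:ℝ) 1 := ⟨by linarith, by linarith⟩
  have h1 := hl _ hmem
  have h2 := hm (Set.Ioo_subset_Icc_self hmem) (by simp : (1:ℝ) ∈ Set.Icc (0:ℝ) 1) hmem.2.le
  linarith

theorem aux_psi_le {ψ : ℝ → ℝ} (hψ : MemPsi ψ) {s : ℝ} (hs : s ∈ Set.Icc (0:ℝ) 1) :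
    s ≤ ψ s := by
  rcases hs.1.eq_or_lt with h | h
  · rw [← h]; exact (hψ.2.2.1 0 (by simp)).1
  rcases hs.2.eq_or_lt with h' | h'
  · rw [h', aux_psi_one hψ]
  · exact (hψ.2.2.2 s ⟨h, h'⟩).le

theorem aux_lim {ψ : ℝ → ℝ} (hψ : MemPsi ψ) {a b : ℕ → ℝ} {L : ℝ} (hL : L ∈ Set.Icc (0:ℝ) 1)
    (hL0 : 0 < L) (hb : ∀ n, b n ∈ Set.Icc (0:ℝ) 1)
    (ha : Tendsto a atTop (𝓝 L)) (hbL : Tendsto b atTop (𝓝 L)) (h : ∀ n, ψ (b n) ≤ a n) :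
    L = 1 := by
  have hcomp : Tendsto (fun n => ψ (b n)) atTop (𝓝 (ψ L)) :=
    (hψ.1 L hL).tendsto.comp
      (tendsto_nhdsWithin_iff.2 ⟨hbL, Filter.Eventually.of_forall hb⟩)
  have h1 : ψ L ≤ L := le_of_tendsto_of_tendsto' hcomp ha h
  rcases hL.2.eq_or_lt with h' | h'
  · exact h'
  · exact absurd (hψ.2.2.2 L ⟨hL0, h'⟩) (not_lt.2 h1)

theorem aux_seq {ψ : ℝ → ℝ} (hψ : MemPsi ψ) {a : ℕ → ℝ} (ha : ∀ n, a n ∈ Set.Icc (0:ℝ) 1)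
    (hpos : 0 < a 0) (h : ∀ n, ψ (a n) ≤ a (n+1)) : Tendsto a atTop (𝓝 1) := by
  have hmono : Monotone a := monotone_nat_of_le_succ fun n => (aux_psi_le hψ (ha n)).trans (h n)
  have hbdd : BddAbove (Set.range a) := ⟨1, by rintro _ ⟨n, rfl⟩; exact (ha n).2⟩
  have ht := tendsto_atTop_ciSup hmono hbdd
  have h0 : a 0 ≤ ⨆ n, a n := le_ciSup hbdd 0
  have h1 : (⨆ n, a n) ≤ 1 := ciSup_le fun n => (ha n).2
  have := aux_lim hψ ⟨by linarith, h1⟩ (by linarith) ha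
    (ht.comp (tendsto_add_atTop_nat 1)) ht h
  rwa [this] at ht

/-- every Miheţ fuzzy ψ-contraction in a KM-FMS is a type-2 fuzzy ample
spectrum contraction w.r.t. `(M, S_X, θ_ψ)`, where `θ_ψ(t,s) = t − ψ(s)`, and it
satisfies (F̃2'), (F̃5), the positivity implication, and `θ_ψ(t,s) ≤ t − s`. -/
theorem psiContraction_implies_FASC2 {X : Type*}
    (M : X → X → ℝ → ℝ) (star : ℝ → ℝ → ℝ) (hKM : IsKMFMS M star)
    (T : X → X) (ψ : ℝ → ℝ) (hψ : MemPsi ψ)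
    (hT : FuzzyPsiContraction M T ψ) :
    IsFASC2 M (fun _ _ => True) T (Set.Icc (0:ℝ) 1 ×ˢ Set.Icc (0:ℝ) 1)
      (fun t s => t - ψ s) ∧
    PropF2tprime M (fun _ _ => True) T (fun t s => t - ψ s) ∧
    PropF5t M (fun _ _ => True) T (fun t s => t - ψ s) ∧
    (∀ t s : ℝ, (t, s) ∈ Set.Icc (0:ℝ) 1 ×ˢ Set.Icc (0:ℝ) 1 →
      0 ≤ t - ψ s → 0 < s → 0 < t) ∧
    (∀ t ∈ Set.Icc (0:ℝ) 1, ∀ s ∈ Set.Icc (0:ℝ) 1, t - ψ s ≤ t - s) := by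
  refine ⟨⟨⟨⟨(0, 0), by simp⟩, ?_⟩, ?_, ?_, ?_⟩, ?_, ?_, ?_, ?_⟩
  · intro x y t ht _ _
    exact ⟨hKM.mem _ _ _ ht, hKM.mem _ _ _ ht⟩
  · intro x _ _ h t ht
    exact aux_seq hψ (fun n => hKM.mem _ _ _ ht.le) (h 0 t ht).1
      fun n => sub_nonneg.1 (h n t ht).2
  · rintro f g ⟨x, y, hxy⟩ t ht L hL hf hg hlt hθ
    have hpos : 0 < L := by
      refine lt_of_le_of_lt ?_ (hlt 0)
      rw [((hxy 0).2.2 t ht).1]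
      exact (hKM.mem _ _ _ ht.le).1
    refine aux_lim hψ hL hpos (fun n => ?_) hf hg fun n => sub_nonneg.1 (hθ n)
    rw [((hxy n).2.2 t ht).2]
    exact hKM.mem _ _ _ ht.le
  · intro x y t ht _ _ hM
    exact sub_nonneg.2 (hT x y t ht hM)
  · intro x y _ _ _ h t ht
    exact aux_seq hψ (fun n => hKM.mem _ _ _ ht.le) (h 0 t ht).1
      fun n => sub_nonneg.1 (h n t ht).2
  · rintro f g ⟨x, y, hxy⟩ _ hg hθ t ht
    refine tendsto_of_tendsto_of_tendsto_of_le_of_le (hg t ht) tendsto_const_nhds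
      (fun n => ?_) (fun n => ?_)
    · have hmem : g n t ∈ Set.Icc (0:ℝ) 1 := by
        rw [((hxy n).2.2 t ht).2]
        exact hKM.mem _ _ _ ht.le
      exact (aux_psi_le hψ hmem).trans (sub_nonneg.1 (hθ n t ht))
    · show f n t ≤ 1
      rw [((hxy n).2.2 t ht).1]
      exact (hKM.mem _ _ _ ht.le).2
  · intro t s hts h hs
    have := aux_psi_le hψ hts.2
    simp only at this
    linarith
  · intro t _ s hs
    have := aux_psi_le hψ hs
    linarith
end

section
/- Let (X, M, ∗) be an M-complete KM-FMS whose t-norm ∗ is continuous at the 1-boundary and such that the fuzzy space (X, M) satisfies property NC, and let T : X → X be a fuzzy ψ-contraction for some ψ ∈ Ψ. If there exists x₀ ∈ X such that M(x₀, T x₀, t) > 0 for all t > 0, then T has a fixed point. -/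
open Filter Topology Set

/-- a fuzzy ψ-contraction on an `M`-complete KM-FMS whose t-norm is
continuous at the 1-boundary and whose fuzzy space satisfies property 𝒩𝒞 has a fixed
point, provided there is a suitable starting point. -/
theorem psiContraction_fixedPoint_NC {X : Type*}
    (M : X → X → ℝ → ℝ) (star : ℝ → ℝ → ℝ) (hKM : IsKMFMS M star)
    (hstar : ContinuousAt1Boundary star)
    (hNC : PropertyNC M)
    (hcomplete : MComplete M)
    (T : X → X) (ψ : ℝ → ℝ) (hψ : MemPsi ψ)
    (hT : FuzzyPsiContraction M T ψ)
    (x₀ : X) (hx₀ : ∀ t : ℝ, 0 < t → 0 < M x₀ (T x₀) t) :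
    ∃ z : X, T z = z := by
  obtain ⟨hc, hmono, hmem, hlt⟩ := hψ
  have hψ1 : ψ 1 = 1 := by
    refine le_antisymm (hmem 1 ⟨zero_le_one, le_rfl⟩).2 ?_
    by_contra! h
    have h0 := (hmem 1 ⟨zero_le_one, le_rfl⟩).1
    have h2 : (ψ 1 + 1) / 2 ∈ Set.Ioo (0:ℝ) 1 := ⟨by linarith, by linarith⟩
    have h3 := hlt _ h2
    have h4 := hmono (Set.Ioo_subset_Icc_self h2) (⟨zero_le_one, le_rfl⟩ : (1:ℝ) ∈ Set.Icc (0:ℝ) 1)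
      h2.2.le
    linarith
  have hge : ∀ s ∈ Set.Icc (0:ℝ) 1, s ≤ ψ s := by
    intro s hs
    rcases hs.1.eq_or_lt with h | h
    · rw [← h]; exact (hmem 0 ⟨le_rfl, zero_le_one⟩).1
    rcases hs.2.eq_or_lt with h' | h'
    · rw [h', hψ1]
    · exact (hlt s ⟨h, h'⟩).le
  -- if `u → L` in `[0,1]` then `ψ ∘ u → ψ L`
  have hcomp : ∀ (u : ℕ → ℝ) (L : ℝ), (∀ n, u n ∈ Set.Icc (0:ℝ) 1) → L ∈ Set.Icc (0:ℝ) 1 →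
      Tendsto u atTop (𝓝 L) → Tendsto (fun n => ψ (u n)) atTop (𝓝 (ψ L)) := by
    intro u L hu hL h
    exact (hc L hL).tendsto.comp
      (tendsto_nhdsWithin_iff.2 ⟨h, Eventually.of_forall hu⟩)
  set x : ℕ → X := fun n => T^[n] x₀ with hx
  have hxs : ∀ n, x (n+1) = T (x n) := fun n => Function.iterate_succ_apply' T n x₀
  have hpos : ∀ n : ℕ, ∀ t : ℝ, 0 < t → 0 < M (x n) (x (n+1)) t := by
    intro n t ht
    induction n with
    | zero => exact hx₀ t ht
    | succ n ih =>
      have h := hT _ _ t ht ih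
      rw [hxs (n+1)]
      nth_rewrite 1 [hxs n]
      exact lt_of_lt_of_le ih ((hge _ (hKM.mem _ _ t ht.le)).trans h)
  have hstep : ∀ n : ℕ, ∀ t : ℝ, 0 < t →
      ψ (M (x n) (x (n+1)) t) ≤ M (x (n+1)) (x (n+1+1)) t := by
    intro n t ht
    have h := hT _ _ t ht (hpos n t ht)
    rwa [← hxs, ← hxs] at h
  have hone : ∀ t : ℝ, 0 < t → Tendsto (fun n => M (x n) (x (n+1)) t) atTop (𝓝 1) := by
    intro t ht
    have hm : Monotone (fun n => M (x n) (x (n+1)) t) :=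
      monotone_nat_of_le_succ fun n =>
        (hge _ (hKM.mem _ _ t ht.le)).trans (hstep n t ht)
    have hb : BddAbove (Set.range (fun n => M (x n) (x (n+1)) t)) :=
      ⟨1, by rintro _ ⟨n, rfl⟩; exact (hKM.mem _ _ t ht.le).2⟩
    obtain ⟨L, hL⟩ : ∃ L, Tendsto (fun n => M (x n) (x (n+1)) t) atTop (𝓝 L) :=
      ⟨_, tendsto_atTop_ciSup hm hb⟩
    have hL0 : 0 < L := (hpos 0 t ht).trans_le (hm.ge_of_tendsto hL 0)
    have hL1 : L ≤ 1 := le_of_tendsto' hL fun n => (hKM.mem _ _ t ht.le).2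
    have h1 := hcomp _ L (fun n => hKM.mem _ _ t ht.le) ⟨hL0.le, hL1⟩ hL
    have h2 : ψ L ≤ L :=
      le_of_tendsto_of_tendsto' h1 ((tendsto_add_atTop_iff_nat 1).2 hL) (fun n => hstep n t ht)
    rcases hL1.eq_or_lt with h | h
    · rwa [h] at hL
    · exact absurd (hlt L ⟨hL0, h⟩) (not_lt.2 h2)
  have hCauchy : MCauchy M x := by
    by_contra hn
    obtain ⟨ε, hε, t, ht, nf, mf, hidx, -, ha, hb⟩ := hNC x hn hone
    have hL : 1 - ε ∈ Set.Ioo (0:ℝ) 1 := ⟨by linarith [hε.2], by linarith [hε.1]⟩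
    have h1 := hcomp _ _ (fun k => hKM.mem (x (nf k - 1)) (x (mf k - 1)) t ht.le)
      (Set.Ioo_subset_Icc_self hL) hb
    have h2 : ψ (1 - ε) ≤ 1 - ε := by
      refine le_of_tendsto_of_tendsto h1 ha ?_
      filter_upwards [hb.eventually (lt_mem_nhds hL.1)] with k hk
      have h := hT _ _ t ht hk
      rw [← hxs, ← hxs] at h
      have e1 : nf k - 1 + 1 = nf k := by have := hidx k; omega
      have e2 : mf k - 1 + 1 = mf k := by have := hidx k; omega
      rwa [e1, e2] at h
    exact absurd (hlt _ hL) (not_lt.2 h2)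
  obtain ⟨z, hz⟩ := hcomplete x hCauchy
  have hzt : ∀ t : ℝ, 0 < t → Tendsto (fun n => M (x n) z t) atTop (𝓝 1) := by
    intro t ht
    rw [tendsto_order]
    refine ⟨fun a ha => ?_, fun a ha => Eventually.of_forall fun n =>
      (hKM.mem _ _ t ht.le).2.trans_lt ha⟩
    have hε : min (1 - a) (1/2) ∈ Set.Ioo (0:ℝ) 1 :=
      ⟨lt_min (by linarith) (by norm_num), (min_le_right _ _).trans_lt (by norm_num)⟩
    obtain ⟨n₀, h⟩ := hz _ hε t ht
    filter_upwards [eventually_ge_atTop n₀] with n hn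
    have := h n hn
    have := min_le_left (1 - a) (1/2)
    linarith
  refine ⟨z, ((hKM.km2 z (T z)).1 fun t ht => ?_).symm⟩
  have ht2 : 0 < t / 2 := by linarith
  have hA : Tendsto (fun n => M z (x (n+1)) (t/2)) atTop (𝓝 1) := by
    have h := (tendsto_add_atTop_iff_nat 1).2 (hzt _ ht2)
    refine h.congr fun n => hKM.km3 _ _ _
  have hB : Tendsto (fun n => M (x (n+1)) (T z) (t/2)) atTop (𝓝 1) := by
    have h := hcomp _ 1 (fun n => hKM.mem (x n) z (t/2) ht2.le) ⟨zero_le_one, le_rfl⟩ (hzt _ ht2)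
    rw [hψ1] at h
    refine tendsto_of_tendsto_of_tendsto_of_le_of_le' h tendsto_const_nhds ?_
      (Eventually.of_forall fun n => (hKM.mem _ _ _ ht2.le).2)
    filter_upwards [(hzt _ ht2).eventually (lt_mem_nhds zero_lt_one)] with n hn
    rw [hxs]
    exact hT _ _ _ ht2 hn
  have hC := hstar _ _ 1 (fun n => hKM.mem _ _ _ ht2.le) (fun n => hKM.mem _ _ _ ht2.le) hA hB
  refine le_antisymm (hKM.mem _ _ t ht.le).2 (le_of_tendsto' hC fun n => ?_)
  have h := hKM.km4 z (x (n+1)) (T z) (t/2) (t/2) ht2.le ht2.le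
  rwa [add_halves] at h
end
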